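/- Let x solve x'(s) = −x(s) + g(x(s), s) on [λ, λ+h] (h > 0), and let f(s) := g(x(s), s) be continuously differentiable on [λ, λ+h]. Then the local defect of the exponential Euler step satisfies ‖x(λ+h) − e^{−h} x(λ) − h φ_1(−h) f(λ)‖ ≤ (1 − e^{−h}) · h · sup_{s ∈ [λ, λ+h]} ‖f'(s)‖. -/

import Mathlib

open MeasureTheory

/-- `phi j h` denotes `φ_j(-h) = h^{-j} ∫_0^h e^{τ-h} τ^{j-1}/(j-1)! dτ` for `j ≥ 1`,
with `φ_0(-h) := e^{-h}` (and the convention `φ_j(0) := 1/j!`);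
in particular `h φ_1(-h) = 1 - e^{-h}`. -/
noncomputable def phi (j : ℕ) (h : ℝ) : ℝ :=
  if h = 0 then 1 / (Nat.factorial j : ℝ)
  else if j = 0 then Real.exp (-h)
  else (1 / h ^ j) *
    ∫ τ in (0:ℝ)..h, Real.exp (τ - h) * τ ^ (j - 1) / (Nat.factorial (j - 1) : ℝ)

theorem mul_phi_one {h : ℝ} (hh : h ≠ 0) : h * phi 1 h = 1 - Real.exp (-h) := by
  simp [phi, hh, intervalIntegral.integral_comp_sub_right]

theorem norm_le_biSup_of_continuousOn {E : Type*} [NormedAddCommGroup E] {u : ℝ → E}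
    {s : Set ℝ} (hs : IsCompact s) (hu : ContinuousOn u s) {t : ℝ} (ht : t ∈ s) :
    ‖u t‖ ≤ ⨆ r ∈ s, ‖u r‖ := by
  obtain ⟨C, hC⟩ := hs.exists_bound_of_continuousOn hu
  have hC0 : 0 ≤ C := (norm_nonneg _).trans (hC t ht)
  have hbdd : BddAbove (Set.range fun r => ⨆ _ : r ∈ s, ‖u r‖) :=
    ⟨C, Set.forall_mem_range.2 fun r => Real.iSup_le (hC r) hC0⟩
  simpa [ht] using le_ciSup hbdd t

/-- Variation of constants: if `x' = -x + f` on `[a, b]` and `f` stays within `K` of the constant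
`c`, then the exponential Euler step with forcing `c` is accurate up to `K (1 - e^{-(b-a)})`. -/
theorem norm_sub_exp_euler_le {E : Type*} [NormedAddCommGroup E] [NormedSpace ℝ E]
    {x f : ℝ → E} {a b K : ℝ} {c : E} (hab : a ≤ b)
    (hx : ∀ s ∈ Set.Icc a b, HasDerivWithinAt x (-x s + f s) (Set.Icc a b) s)
    (hf : ∀ s ∈ Set.Icc a b, ‖f s - c‖ ≤ K) :
    ‖x b - Real.exp (a - b) • x a - (1 - Real.exp (a - b)) • c‖ ≤
      (1 - Real.exp (a - b)) * K := by
  have hexp (s : ℝ) : HasDerivAt (fun s => Real.exp (s - b)) (Real.exp (s - b)) s := by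
    simpa using ((hasDerivAt_id s).sub_const b).exp
  have hderiv (s : ℝ) (hs : s ∈ Set.Icc a b) :
      HasDerivWithinAt (fun s => Real.exp (s - b) • (x s - c) - Real.exp (a - b) • (x a - c))
        (Real.exp (s - b) • (f s - c)) (Set.Icc a b) s :=
    (((hexp s).hasDerivWithinAt.smul ((hx s hs).sub_const c)).sub_const
      (Real.exp (a - b) • (x a - c))).congr_deriv (by module)
  have hB (s : ℝ) : HasDerivAt (fun s => (Real.exp (s - b) - Real.exp (a - b)) * K)
      (Real.exp (s - b) * K) s := ((hexp s).sub_const _).mul_const K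
  have key := image_norm_le_of_norm_deriv_right_le_deriv_boundary
    (fun s hs => (hderiv s hs).continuousWithinAt)
    (fun s hs => (hderiv s (Set.Ico_subset_Icc_self hs)).mono_of_mem_nhdsWithin
      (Icc_mem_nhdsGE_of_mem hs)) (by simp) hB
    (fun s hs => by
      rw [norm_smul, Real.norm_of_nonneg (Real.exp_pos _).le]
      exact mul_le_mul_of_nonneg_left (hf s (Set.Ico_subset_Icc_self hs)) (Real.exp_pos _).le)
    (Set.right_mem_Icc.2 hab)
  simp only [sub_self, Real.exp_zero] at key
  convert key using 2
  module

/-- **Local defect of the exponential Euler (DDIM) step.**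
If `x` solves `dx/dλ = -x + g(x, λ)` on `[λ, λ+h]` and `f(s) := g(x(s), s)` is continuously
differentiable there, then
`‖x(λ+h) - e^{-h} x(λ) - h φ_1(-h) f(λ)‖ ≤ (1 - e^{-h}) h sup_{s∈[λ,λ+h]} ‖f'(s)‖`. -/
theorem stmt_5 (d : ℕ)
    (g : EuclideanSpace ℝ (Fin d) → ℝ → EuclideanSpace ℝ (Fin d))
    (x : ℝ → EuclideanSpace ℝ (Fin d)) (lam h : ℝ) (hh : 0 < h)
    (hx : ∀ s ∈ Set.Icc lam (lam + h),
      HasDerivWithinAt x (-x s + g (x s) s) (Set.Icc lam (lam + h)) s)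
    (f : ℝ → EuclideanSpace ℝ (Fin d)) (hf : f = fun s => g (x s) s)
    (hf1 : ContDiffOn ℝ 1 f (Set.Icc lam (lam + h))) :
    ‖x (lam + h) - Real.exp (-h) • x lam - (h * phi 1 h) • f lam‖ ≤
      (1 - Real.exp (-h)) * h *
        ⨆ s ∈ Set.Icc lam (lam + h), ‖derivWithin f (Set.Icc lam (lam + h)) s‖ := by
  have hlt : lam < lam + h := by linarith
  have hI := uniqueDiffOn_Icc hlt
  set I := Set.Icc lam (lam + h)
  set M := ⨆ s ∈ I, ‖derivWithin f I s‖
  have hM (s : ℝ) (hs : s ∈ I) : ‖derivWithin f I s‖ ≤ M :=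
    norm_le_biSup_of_continuousOn isCompact_Icc (hf1.continuousOn_derivWithin hI le_rfl) hs
  have hlam : lam ∈ I := Set.left_mem_Icc.2 hlt.le
  have hM0 : 0 ≤ M := (norm_nonneg _).trans (hM lam hlam)
  have hfK (s : ℝ) (hs : s ∈ I) : ‖f s - f lam‖ ≤ h * M := by
    have hsh : ‖s - lam‖ ≤ h := by
      rw [Real.norm_of_nonneg (sub_nonneg.2 hs.1)]
      linarith [hs.2]
    calc ‖f s - f lam‖ ≤ M * ‖s - lam‖ :=
          (convex_Icc _ _).norm_image_sub_le_of_norm_derivWithin_le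
            (hf1.differentiableOn one_ne_zero) hM hlam hs
      _ ≤ M * h := mul_le_mul_of_nonneg_left hsh hM0
      _ = h * M := mul_comm _ _
  have key := norm_sub_exp_euler_le (f := f) hlt.le (by simpa only [hf] using hx) hfK
  rw [mul_phi_one hh.ne']
  rwa [show lam - (lam + h) = -h by ring, ← mul_assoc] at key
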